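/- There exists a constant C > 0 such that for all integers n ≥ 2, |Σ_{2 < p < n^{2/3}, p prime} (α_p(n) − β_p(n))·log p − Σ_{2 < p < n^{2/3}, p prime} (1 + (−1/p))·n·log p/(p−1)| ≤ C·n^{2/3}. -/

import Mathlib

open scoped Classical

theorem not_dvd_two_mul_of_dvd_sq_add_one {p : ℕ} (hp : p.Prime) (hp2 : p ≠ 2) {r : ℤ}
    (hr : (p : ℤ) ∣ r ^ 2 + 1) : ¬ (p : ℤ) ∣ 2 * r := by
  intro hd
  have h4 : (p : ℤ) ∣ 2 ^ 2 := by
    have := (hr.mul_left 4).sub (hd.mul_left (2 * r))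
    ring_nf at this
    exact this
  have := Int.le_of_dvd (by norm_num) ((Nat.prime_iff_prime_int.1 hp).dvd_of_dvd_pow h4)
  have := hp.two_le
  omega

theorem exists_pow_dvd_sq_add_one {p : ℕ} (hp : p.Prime) (h : p % 4 = 1) (k : ℕ) :
    ∃ r : ℤ, (p : ℤ) ^ (k + 1) ∣ r ^ 2 + 1 := by
  have := Fact.mk hp
  induction k with
  | zero =>
    obtain ⟨y, hy⟩ := ZMod.exists_sq_eq_neg_one_iff.2 (show p % 4 ≠ 3 by omega)
    obtain ⟨z, rfl⟩ := ZMod.intCast_surjective y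
    refine ⟨z, ?_⟩
    rw [zero_add, pow_one, ← ZMod.intCast_zmod_eq_zero_iff_dvd]
    push_cast
    rw [sq, ← hy]
    ring
  | succ k ih =>
    obtain ⟨r, m, hm⟩ := ih
    have hpi : Prime (p : ℤ) := Nat.prime_iff_prime_int.1 hp
    have hpr := not_dvd_two_mul_of_dvd_sq_add_one hp (by rintro rfl; omega)
      ((dvd_pow_self _ k.succ_ne_zero).trans ⟨m, hm⟩)
    obtain ⟨u, v, huv⟩ := (Prime.coprime_iff_not_dvd hpi).2 hpr
    refine ⟨r - v * m * p ^ (k + 1), u * m + v ^ 2 * m ^ 2 * p ^ k, ?_⟩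
    linear_combination hm - (p : ℤ) ^ (k + 1) * m * huv

theorem exists_sq_add_one_dvd_iff {p : ℕ} (hp : p.Prime) (h : p % 4 = 1) (k : ℕ) :
    ∃ r s : ℕ, ¬ r ≡ s [MOD p ^ (k + 1)] ∧
      ∀ x : ℕ, p ^ (k + 1) ∣ x ^ 2 + 1 ↔ x ≡ r [MOD p ^ (k + 1)] ∨ x ≡ s [MOD p ^ (k + 1)] := by
  obtain ⟨r, hr⟩ := exists_pow_dvd_sq_add_one hp h k
  have hpi : Prime (p : ℤ) := Nat.prime_iff_prime_int.1 hp
  have hq : (0 : ℤ) < (p : ℤ) ^ (k + 1) := by have := hp.pos; positivity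
  have hpr := not_dvd_two_mul_of_dvd_sq_add_one hp (by rintro rfl; omega)
    ((dvd_pow_self _ k.succ_ne_zero).trans hr)
  have key (z : ℤ) : ((z % (p : ℤ) ^ (k + 1)).toNat : ℤ) = z % (p : ℤ) ^ (k + 1) :=
    Int.toNat_of_nonneg (Int.emod_nonneg _ hq.ne')
  refine ⟨(r % (p : ℤ) ^ (k + 1)).toNat, (-r % (p : ℤ) ^ (k + 1)).toNat, ?_, fun x ↦ ?_⟩
  · rw [← Int.natCast_modEq_iff, key, key, Nat.cast_pow]
    intro hc
    have hc' : -r ≡ r [ZMOD (p : ℤ) ^ (k + 1)] :=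
      (Int.mod_modEq _ _).symm.trans (hc.symm.trans (Int.mod_modEq _ _))
    refine hpr ((dvd_pow_self _ k.succ_ne_zero).trans ?_)
    have := hc'.dvd
    rwa [sub_neg_eq_add, ← two_mul] at this
  · have e (z : ℤ) : (x : ℤ) ≡ z % (p : ℤ) ^ (k + 1) [ZMOD (p : ℤ) ^ (k + 1)] ↔
        (p : ℤ) ^ (k + 1) ∣ x - z := by
      rw [← Int.modEq_iff_dvd]
      exact ⟨fun h ↦ (Int.mod_modEq _ _).symm.trans h.symm,
        fun h ↦ h.symm.trans (Int.mod_modEq _ _).symm⟩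
    rw [← Int.natCast_modEq_iff, ← Int.natCast_modEq_iff, key, key, Nat.cast_pow, e, e,
      ← Int.natCast_dvd_natCast]
    push_cast
    have hdvd : (p : ℤ) ^ (k + 1) ∣ (x : ℤ) ^ 2 + 1 ↔
        (p : ℤ) ^ (k + 1) ∣ (x - r) * (x - -r) := by
      rw [← dvd_sub_left hr]
      ring_nf
    rw [hdvd]
    refine ⟨fun hx ↦ ?_, fun hx ↦ hx.elim (fun h ↦ h.mul_right _) fun h ↦ h.mul_left _⟩
    by_cases h1 : (p : ℤ) ∣ x - r
    · left
      refine ((Prime.coprime_iff_not_dvd hpi).2 fun h2 ↦ hpr ?_).pow_left.dvd_of_dvd_mul_right hx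
      have := h2.sub h1
      ring_nf at this ⊢
      exact this
    · right
      exact ((Prime.coprime_iff_not_dvd hpi).2 h1).pow_left.dvd_of_dvd_mul_left hx

theorem abs_card_Ioc_filter_modEq_sub_le (n : ℕ) {q : ℕ} (hq : 0 < q) (v : ℕ) :
    |(((Finset.Ioc 0 n).filter (· ≡ v [MOD q])).card : ℝ) - n / q| ≤ 1 := by
  have h := Nat.Ioc_filter_modEq_card 0 n hq v
  have hq' : (0 : ℚ) < q := by exact_mod_cast hq
  set c := ((Finset.Ioc 0 n).filter (· ≡ v [MOD q])).card
  have hle : ⌊(((0 : ℕ) : ℚ) - v) / q⌋ ≤ ⌊((n : ℚ) - v) / q⌋ := by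
    gcongr
    positivity
  rw [max_eq_left (by omega)] at h
  have h' : (c : ℚ) = ⌊((n : ℚ) - v) / q⌋ - ⌊(((0 : ℕ) : ℚ) - v) / q⌋ := by exact_mod_cast h
  have hs : (n : ℚ) / q = ((n : ℚ) - v) / q - (((0 : ℕ) : ℚ) - v) / q := by
    field_simp
    simp
  have : |(c : ℚ) - n / q| ≤ 1 := by
    rw [h', hs, abs_le]
    have h1 := Int.floor_le (((n : ℚ) - v) / q)
    have h2 := Int.lt_floor_add_one (((n : ℚ) - v) / q)
    have h3 := Int.floor_le ((((0 : ℕ) : ℚ) - v) / q)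
    have h4 := Int.lt_floor_add_one ((((0 : ℕ) : ℚ) - v) / q)
    constructor <;> linarith
  have := (Rat.cast_le (K := ℝ)).2 this
  push_cast at this
  exact this

theorem abs_card_pow_dvd_sq_add_one_sub_le {p : ℕ} (hp : p.Prime) (h : p % 4 = 1) (n k : ℕ) :
    |(((Finset.Icc 1 n).filter (fun i ↦ p ^ (k + 1) ∣ i ^ 2 + 1)).card : ℝ)
      - 2 * n / (p : ℝ) ^ (k + 1)| ≤ 2 := by
  obtain ⟨r, s, hrs, hx⟩ := exists_sq_add_one_dvd_iff hp h k
  have hq : 0 < p ^ (k + 1) := pow_pos hp.pos _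
  have hI : Finset.Icc 1 n = Finset.Ioc 0 n := rfl
  simp_rw [hx, hI]
  rw [Finset.filter_or, Finset.card_union_of_disjoint]
  · have h1 := abs_le.1 (abs_card_Ioc_filter_modEq_sub_le n hq r)
    have h2 := abs_le.1 (abs_card_Ioc_filter_modEq_sub_le n hq s)
    have : 2 * n / (p : ℝ) ^ (k + 1) = n / (p ^ (k + 1) : ℕ) + n / (p ^ (k + 1) : ℕ) := by
      push_cast
      ring
    rw [this, abs_le]
    push_cast at *
    constructor <;> linarith [h1.1, h1.2, h2.1, h2.2]
  · rw [Finset.disjoint_filter]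
    exact fun x _ h1 h2 ↦ hrs (h1.symm.trans h2)

theorem factorization_prod_sq_add_one {p : ℕ} (hp : p.Prime) (n : ℕ) :
    (∏ i ∈ Finset.Icc 1 n, (i ^ 2 + 1)).factorization p =
      ∑ k ∈ Finset.range (Nat.log p (n ^ 2 + 1)),
        ((Finset.Icc 1 n).filter (fun i ↦ p ^ (k + 1) ∣ i ^ 2 + 1)).card := by
  rw [Nat.factorization_prod_apply fun _ _ ↦ by positivity]
  have (i : ℕ) (hi : i ∈ Finset.Icc 1 n) : (i ^ 2 + 1).factorization p =
      ∑ k ∈ Finset.range (Nat.log p (n ^ 2 + 1)), if p ^ (k + 1) ∣ i ^ 2 + 1 then 1 else 0 := by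
    rw [Nat.factorization_eq_card_pow_dvd_of_lt hp (by positivity)
      (b := Nat.log p (n ^ 2 + 1) + 1), Finset.card_filter, Finset.sum_Ico_eq_sum_range]
    · simp [add_comm]
    · refine lt_of_le_of_lt ?_ (Nat.lt_pow_succ_log_self hp.one_lt _)
      gcongr
      exact (Finset.mem_Icc.1 hi).2
  rw [Finset.sum_congr rfl this, Finset.sum_comm]
  simp_rw [Finset.card_filter]

theorem factorization_lcm_sq_add_one_le {p : ℕ} (hp : p.Prime) (n : ℕ) :
    ((Finset.Icc 1 n).lcm (fun i ↦ i ^ 2 + 1)).factorization p ≤ Nat.log p (n ^ 2 + 1) := by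
  rw [Finset.factorization_lcm fun _ _ ↦ by positivity, Finset.sup_le_iff]
  intro i hi
  refine Nat.le_log_of_pow_le hp.one_lt ((Nat.ordProj_le p (by positivity)).trans ?_)
  gcongr
  exact (Finset.mem_Icc.1 hi).2

theorem abs_factorization_prod_sq_add_one_sub_le {p : ℕ} (hp : p.Prime) (h : p % 4 = 1)
    {n : ℕ} (hn : 1 ≤ n) :
    |((∏ i ∈ Finset.Icc 1 n, (i ^ 2 + 1)).factorization p : ℝ) - 2 * n / ((p : ℝ) - 1)| ≤
      2 * (Nat.log p (n ^ 2 + 1) : ℝ) + 4 := by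
  set K := Nat.log p (n ^ 2 + 1) with hK
  have hp2 : (2 : ℝ) ≤ p := by exact_mod_cast hp.two_le
  have hn' : (1 : ℝ) ≤ n := by exact_mod_cast hn
  have hgeom : ∑ k ∈ Finset.range K, 2 * (n : ℝ) / (p : ℝ) ^ (k + 1) =
      2 * n / ((p : ℝ) - 1) - 2 * n / ((p : ℝ) ^ K * (p - 1)) := by
    have hp1 : (p : ℝ) - 1 ≠ 0 := by linarith
    clear hK
    clear_value K
    induction K with
    | zero => simp
    | succ K ih =>
      rw [Finset.sum_range_succ, ih]
      field_simp
      ring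
  have htail : 2 * n / ((p : ℝ) ^ K * (p - 1)) ≤ 4 := by
    have hlt : (n : ℝ) ^ 2 + 1 < (p : ℝ) ^ K * p := by
      rw [← pow_succ]
      exact_mod_cast Nat.lt_pow_succ_log_self hp.one_lt (n ^ 2 + 1)
    have hpK : (0 : ℝ) < (p : ℝ) ^ K := by positivity
    rw [div_le_iff₀ (mul_pos hpK (by linarith))]
    nlinarith
  have htail0 : 0 ≤ 2 * n / ((p : ℝ) ^ K * (p - 1)) :=
    div_nonneg (by positivity) (mul_nonneg (by positivity) (by linarith))
  have hsum : |∑ k ∈ Finset.range K,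
      ((((Finset.Icc 1 n).filter (fun i ↦ p ^ (k + 1) ∣ i ^ 2 + 1)).card : ℝ)
        - 2 * n / (p : ℝ) ^ (k + 1))| ≤ 2 * K := by
    refine (Finset.abs_sum_le_sum_abs _ _).trans
      ((Finset.sum_le_sum fun k _ ↦ abs_card_pow_dvd_sq_add_one_sub_le hp h n k).trans ?_)
    simp [mul_comm]
  rw [Finset.sum_sub_distrib, hgeom] at hsum
  rw [factorization_prod_sq_add_one hp, ← hK]
  push_cast
  rw [abs_le] at *
  constructor <;> linarith [hsum.1, hsum.2]

theorem factorization_sq_add_one_eq_zero {p : ℕ} (hp : p.Prime) (h : p % 4 = 3) (i : ℕ) :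
    (i ^ 2 + 1).factorization p = 0 := by
  have := Fact.mk hp
  refine Nat.factorization_eq_zero_of_not_dvd fun hd ↦ ?_
  refine ZMod.exists_sq_eq_neg_one_iff.1 ⟨(i : ZMod p), ?_⟩ h
  rw [← ZMod.natCast_eq_zero_iff] at hd
  push_cast at hd
  linear_combination -hd

theorem abs_valuation_diff_mul_log_sub_le {p n : ℕ} (hp : p.Prime) (hp2 : 2 < p) (hn : 2 ≤ n)
    (hpn : p ≤ n) :
    |((padicValNat p (∏ i ∈ Finset.Icc 1 n, (i ^ 2 + 1)) : ℝ)
        - (padicValNat p ((Finset.Icc 1 n).lcm (fun i => i ^ 2 + 1)) : ℝ)) * Real.log p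
      - (1 + (if p % 4 = 1 then (1 : ℝ) else -1)) * n * Real.log p / ((p : ℝ) - 1)| ≤
      13 * Real.log n := by
  have hlogn : 0 ≤ Real.log n := Real.log_natCast_nonneg n
  rw [← Nat.factorization_def _ hp, ← Nat.factorization_def _ hp]
  by_cases h : p % 4 = 1
  · have hα := abs_factorization_prod_sq_add_one_sub_le hp h (show 1 ≤ n by omega)
    have hβ : (((Finset.Icc 1 n).lcm (fun i ↦ i ^ 2 + 1)).factorization p : ℝ) ≤
      Nat.log p (n ^ 2 + 1) := by exact_mod_cast factorization_lcm_sq_add_one_le hp n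
    have hβ0 : (0 : ℝ) ≤ (((Finset.Icc 1 n).lcm (fun i ↦ i ^ 2 + 1)).factorization p : ℝ) :=
      Nat.cast_nonneg _
    have hlogp : 0 ≤ Real.log p := Real.log_natCast_nonneg p
    have hpn' : Real.log p ≤ Real.log n :=
      Real.log_le_log (by exact_mod_cast hp.pos) (by exact_mod_cast hpn)
    have hK : Nat.log p (n ^ 2 + 1) * Real.log p ≤ 3 * Real.log n := by
      have h1 : p ^ Nat.log p (n ^ 2 + 1) ≤ n ^ 3 :=
        (Nat.pow_log_le_self p (by positivity)).trans (by nlinarith [sq_nonneg n])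
      have h2 : (p : ℝ) ^ Nat.log p (n ^ 2 + 1) ≤ (n : ℝ) ^ 3 := by exact_mod_cast h1
      have := Real.log_le_log (pow_pos (by exact_mod_cast hp.pos) _) h2
      rw [Real.log_pow, Real.log_pow] at this
      exact_mod_cast this
    generalize ((∏ i ∈ Finset.Icc 1 n, (i ^ 2 + 1)).factorization p : ℝ) = α at *
    generalize (((Finset.Icc 1 n).lcm (fun i ↦ i ^ 2 + 1)).factorization p : ℝ) = β at *
    generalize (Nat.log p (n ^ 2 + 1) : ℝ) = K at *
    rw [if_pos h, show (α - β) * Real.log p - (1 + 1) * n * Real.log p / ((p : ℝ) - 1) =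
      (α - 2 * n / ((p : ℝ) - 1) - β) * Real.log p by ring, abs_mul, abs_of_nonneg hlogp]
    have : |α - 2 * n / ((p : ℝ) - 1) - β| ≤ 3 * K + 4 := by
      rw [abs_le] at *
      constructor <;> linarith [hα.1, hα.2]
    calc _ ≤ (3 * K + 4) * Real.log p := by gcongr
      _ ≤ _ := by linarith
  · have h3 : p % 4 = 3 := by
      have := hp.eq_two_or_odd
      omega
    rw [Nat.factorization_prod_apply fun _ _ ↦ by positivity,
      Finset.factorization_lcm fun _ _ ↦ by positivity]
    simp only [factorization_sq_add_one_eq_zero hp h3, h, ← Nat.bot_eq_zero, Finset.sup_bot]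
    simp [hlogn]

theorem primeCounting_mul_log_le {x : ℝ} (hx : 1 < x) :
    (Nat.primeCounting ⌊x⌋₊ : ℝ) * Real.log x ≤ (2 * Real.log 4 + 2) * x := by
  have hs1 : 1 < √x := Real.lt_sqrt_of_sq_lt (by simpa using hx)
  have hs : 0 < Real.log √x := Real.log_pos hs1
  have hlog : Real.log x = 2 * Real.log √x := by
    rw [Real.log_sqrt (by linarith)]
    ring
  have h2 : Real.log √x ≤ √x := Real.log_le_self (by positivity)
  calc _ ≤ (Real.log 4 * x / Real.log √x + √x) * (2 * Real.log √x) := by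
        rw [hlog]
        gcongr
        exact Chebyshev.pi_le_log4_mul_div hx
    _ = 2 * Real.log 4 * x + 2 * (√x * Real.log √x) := by field_simp
    _ ≤ 2 * Real.log 4 * x + 2 * (√x * √x) := by gcongr
    _ = _ := by
      rw [Real.mul_self_sqrt (by linarith)]
      ring

/-- There exists `C > 0` such that for all `n ≥ 2`,
`|Σ_{2 < p < n^{2/3}} (α_p(n) − β_p(n))·log p − Σ_{2 < p < n^{2/3}} (1+(−1/p))·n·log p/(p−1)| ≤ C·n^{2/3}`. -/
theorem small_primes_contribution :
    ∃ C > 0, ∀ n : ℕ, 2 ≤ n →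
      |(∑ p ∈ (Finset.range (n + 1)).filter
            (fun p : ℕ => p.Prime ∧ 2 < p ∧ (p : ℝ) < (n : ℝ) ^ ((2 : ℝ) / 3)),
          ((padicValNat p (∏ i ∈ Finset.Icc 1 n, (i ^ 2 + 1)) : ℝ)
            - (padicValNat p ((Finset.Icc 1 n).lcm (fun i => i ^ 2 + 1)) : ℝ)) * Real.log p)
        - ∑ p ∈ (Finset.range (n + 1)).filter
            (fun p : ℕ => p.Prime ∧ 2 < p ∧ (p : ℝ) < (n : ℝ) ^ ((2 : ℝ) / 3)),
          (1 + (if p % 4 = 1 then (1 : ℝ) else -1)) * n * Real.log p / ((p : ℝ) - 1)|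
      ≤ C * (n : ℝ) ^ ((2 : ℝ) / 3) := by
  refine ⟨13 * (3 / 2) * (2 * Real.log 4 + 2), by positivity, fun n hn ↦ ?_⟩
  set x : ℝ := (n : ℝ) ^ ((2 : ℝ) / 3) with hx
  have hn1 : (1 : ℝ) < n := by exact_mod_cast hn
  have hx1 : 1 < x := Real.one_lt_rpow hn1 (by norm_num)
  have hlog : Real.log n = 3 / 2 * Real.log x := by
    rw [hx, Real.log_rpow (by linarith)]
    ring
  rw [← Finset.sum_sub_distrib]
  refine (Finset.abs_sum_le_sum_abs _ _).trans ((Finset.sum_le_card_nsmul _ _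
    (13 * Real.log n) fun p hp ↦ ?_).trans ?_)
  · simp only [Finset.mem_filter, Finset.mem_range] at hp
    exact abs_valuation_diff_mul_log_sub_le hp.2.1 hp.2.2.1 hn (by omega)
  · rw [nsmul_eq_mul]
    have hcard : ((Finset.range (n + 1)).filter
        (fun p : ℕ => p.Prime ∧ 2 < p ∧ (p : ℝ) < x)).card ≤ Nat.primeCounting ⌊x⌋₊ := by
      rw [← Nat.primesLE_card_eq_primeCounting]
      refine Finset.card_le_card fun p hp ↦ ?_
      simp only [Finset.mem_filter] at hp
      exact Nat.mem_primesLE.2 ⟨Nat.le_floor hp.2.2.2.le, hp.2.1⟩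
    have hlog0 : 0 ≤ Real.log n := Real.log_natCast_nonneg n
    calc _ ≤ (Nat.primeCounting ⌊x⌋₊ : ℝ) * (13 * Real.log n) := by gcongr
      _ = 13 * (3 / 2) * (Nat.primeCounting ⌊x⌋₊ * Real.log x) := by
        rw [hlog]
        ring
      _ ≤ 13 * (3 / 2) * ((2 * Real.log 4 + 2) * x) := by
        exact mul_le_mul_of_nonneg_left (primeCounting_mul_log_le hx1) (by norm_num)
      _ = _ := by ring
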